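/- Let $G_1 \sim \mathrm{Gumbel}(\nu_1,1)$ and $G_2 \sim \mathrm{Gumbel}(\nu_2,1)$ be independent. Then $\mathbb{E}[G_1 \mid G_1 \geq G_2] = \gamma + \nu_1 + \log(1 + e^{-(\nu_1 - \nu_2)})$, where $\gamma$ is the Euler–Mascheroni constant. -/

import Mathlib

open MeasureTheory ProbabilityTheory Real

theorem integral_Ioi_log_mul_exp_neg :
    ∫ t in Set.Ioi (0 : ℝ), log t * exp (-t) = -Real.eulerMascheroniConstant := by
  have h₁ := Complex.hasDerivAt_GammaIntegral (s := 1) (by simp)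
  have h₂ := Complex.hasDerivAt_Gamma_one
  have h₃ : Complex.Gamma =ᶠ[nhds 1] Complex.GammaIntegral := by
    have : {s : ℂ | 0 < s.re} ∈ nhds (1 : ℂ) :=
      (isOpen_lt continuous_const Complex.continuous_re).mem_nhds (by simp)
    filter_upwards [this] with s hs using Complex.Gamma_eq_integral hs
  have h := h₁.unique (h₂.congr_of_eventuallyEq h₃.symm)
  simp only [sub_self, Complex.cpow_zero, one_mul] at h
  rw [← Complex.ofReal_inj, ← integral_complex_ofReal]
  push_cast
  exact_mod_cast h

theorem integrableOn_Ioi_log_mul_exp_neg :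
    IntegrableOn (fun t ↦ log t * exp (-t)) (Set.Ioi (0 : ℝ)) := by
  by_contra h
  have := integral_Ioi_log_mul_exp_neg
  rw [integral_undef h] at this
  linarith [one_half_lt_eulerMascheroniConstant]

theorem integral_Ioi_exp_neg_mul {c : ℝ} (hc : 0 < c) :
    ∫ t in Set.Ioi (0 : ℝ), exp (-(c * t)) = c⁻¹ := by
  rw [integral_comp_mul_left_Ioi (fun t ↦ exp (-t)) 0 hc, mul_zero, integral_exp_neg_Ioi_zero,
    smul_eq_mul, mul_one]

theorem integral_Ioi_log_mul_exp_neg_mul {c : ℝ} (hc : 0 < c) :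
    ∫ t in Set.Ioi (0 : ℝ), log t * exp (-(c * t)) =
      c⁻¹ * (-Real.eulerMascheroniConstant - log c) := by
  have hexp : IntegrableOn (fun t : ℝ ↦ exp (-t)) (Set.Ioi 0) := by
    simpa using exp_neg_integrableOn_Ioi 0 one_pos
  calc ∫ t in Set.Ioi (0 : ℝ), log t * exp (-(c * t))
    _ = ∫ t in Set.Ioi (0 : ℝ), (log (c * t) - log c) * exp (-(c * t)) := by
      refine setIntegral_congr_fun measurableSet_Ioi fun t ht ↦ ?_
      rw [log_mul hc.ne' (ne_of_gt ht), add_sub_cancel_left]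
    _ = c⁻¹ * ∫ t in Set.Ioi (0 : ℝ), (log t - log c) * exp (-t) := by
      rw [integral_comp_mul_left_Ioi (fun t ↦ (log t - log c) * exp (-t)) 0 hc, mul_zero,
        smul_eq_mul]
    _ = c⁻¹ * (-Real.eulerMascheroniConstant - log c) := by
      simp_rw [sub_mul]
      rw [integral_sub integrableOn_Ioi_log_mul_exp_neg (hexp.const_mul _), integral_const_mul,
        integral_Ioi_log_mul_exp_neg, integral_exp_neg_Ioi_zero, mul_one]

theorem expMeasure_Ici {r : ℝ} (hr : 0 < r) (x : ℝ) :
    expMeasure r (Set.Ici x) = ENNReal.ofReal (if 0 ≤ x then exp (-(r * x)) else 1) := by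
  have := isProbabilityMeasure_expMeasure hr
  have : NullSingletonClass (expMeasure r) := ⟨fun x ↦
    withDensity_absolutelyContinuous volume (gammaPDF 1 r) (measure_singleton x)⟩
  rw [measure_congr Ioi_ae_eq_Ici.symm, ← ofReal_measureReal, ← Set.compl_Iic,
    probReal_compl_eq_one_sub measurableSet_Iic, ← cdf_eq_real, cdf_expMeasure_eq hr]
  split_ifs <;> simp

theorem integral_expMeasure {r : ℝ} (hr : 0 < r) (f : ℝ → ℝ) :
    ∫ x, f x ∂(expMeasure r) = r * ∫ x in Set.Ioi 0, f x * exp (-(r * x)) := by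
  have : expMeasure r = volume.withDensity (exponentialPDF r) := rfl
  rw [this, integral_withDensity_eq_integral_toReal_smul (f := exponentialPDF r)
    (measurable_exponentialPDFReal r).ennreal_ofReal (by simp [exponentialPDF]),
    ← integral_Ici_eq_integral_Ioi, ← integral_const_mul, ← integral_indicator measurableSet_Ici]
  congr 1 with x
  by_cases hx : 0 ≤ x
  · rw [exponentialPDF_of_nonneg hx, ENNReal.toReal_ofReal (by positivity),
      Set.indicator_of_mem (Set.mem_Ici.2 hx), smul_eq_mul]
    ring
  · rw [exponentialPDF_of_neg (not_le.1 hx), Set.indicator_of_notMem (by simpa using hx)]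
    simp

theorem setIntegral_prod_expMeasure_le {a b : ℝ} (ha : 0 < a) (hb : 0 < b) {f : ℝ → ℝ}
    (hf : Integrable f (expMeasure a)) :
    ∫ p in {p : ℝ × ℝ | p.1 ≤ p.2}, f p.1 ∂((expMeasure a).prod (expMeasure b)) =
      a * ∫ x in Set.Ioi 0, f x * exp (-((a + b) * x)) := by
  have := isProbabilityMeasure_expMeasure ha
  have := isProbabilityMeasure_expMeasure hb
  have hs : MeasurableSet {p : ℝ × ℝ | p.1 ≤ p.2} := measurableSet_le measurable_fst measurable_snd
  rw [← integral_indicator hs, integral_prod _ ((hf.comp_fst _).indicator hs)]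
  have key (x : ℝ) : ∫ y, {p : ℝ × ℝ | p.1 ≤ p.2}.indicator (fun p ↦ f p.1) (x, y) ∂(expMeasure b)
      = (if 0 ≤ x then exp (-(b * x)) else 1) * f x := by
    have : (fun y ↦ {p : ℝ × ℝ | p.1 ≤ p.2}.indicator (fun p ↦ f p.1) (x, y)) =
        (Set.Ici x).indicator fun _ ↦ f x := by
      ext y; simp [Set.indicator]
    rw [this, integral_indicator_const _ measurableSet_Ici, measureReal_def, expMeasure_Ici hb,
      ENNReal.toReal_ofReal (by split_ifs <;> positivity), smul_eq_mul]
  simp_rw [key]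
  rw [integral_expMeasure ha]
  congr 1
  refine setIntegral_congr_fun measurableSet_Ioi fun x (hx : 0 < x) ↦ ?_
  simp only [if_pos hx.le]
  rw [show -((a + b) * x) = -(b * x) + -(a * x) by ring, exp_add]
  ring

theorem map_exp_neg_eq_expMeasure {Ω : Type*} [MeasurableSpace Ω] {μ : Measure Ω}
    [IsProbabilityMeasure μ] {G : Ω → ℝ} {ν : ℝ} (hG : Measurable G)
    (hcdf : ∀ x, μ {ω | G ω ≤ x} = ENNReal.ofReal (exp (-exp (-(x - ν))))) :
    μ.map (fun ω ↦ exp (-G ω)) = expMeasure (exp ν) := by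
  have hm : Measurable fun ω ↦ exp (-G ω) := by fun_prop
  have := Measure.isProbabilityMeasure_map (μ := μ) hm.aemeasurable
  refine Measure.ext_of_Ici _ _ fun x ↦ ?_
  rw [Measure.map_apply hm measurableSet_Ici, expMeasure_Ici (exp_pos ν)]
  rcases le_or_gt x 0 with hx | hx
  · have : (fun ω ↦ exp (-G ω)) ⁻¹' Set.Ici x = Set.univ :=
      Set.eq_univ_of_forall fun ω ↦ hx.trans (exp_pos _).le
    rw [this, measure_univ]
    split_ifs with h
    · simp [le_antisymm hx h]
    · simp
  · have : (fun ω ↦ exp (-G ω)) ⁻¹' Set.Ici x = {ω | G ω ≤ -log x} := by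
      ext ω
      simp only [Set.mem_preimage, Set.mem_Ici, Set.mem_ofPred_eq, ← log_le_iff_le_exp hx]
      exact le_neg
    rw [this, hcdf, if_pos hx.le, show -(-log x - ν) = ν + log x by ring, exp_add, exp_log hx]

/-- For independent G₁ ~ Gumbel(ν₁,1) and G₂ ~ Gumbel(ν₂,1),
E[G₁ ∣ G₁ ≥ G₂] = γ + ν₁ + log(1 + e^{-(ν₁ - ν₂)}), where γ is the
Euler–Mascheroni constant. -/
theorem gumbel_cond_exp_of_larger {Ω : Type*} [MeasurableSpace Ω] (μ : Measure Ω)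
    [IsProbabilityMeasure μ]
    (G₁ G₂ : Ω → ℝ) (ν₁ ν₂ : ℝ)
    (hmeas₁ : Measurable G₁) (hmeas₂ : Measurable G₂)
    (hindep : IndepFun G₁ G₂ μ)
    (hcdf₁ : ∀ x, μ {ω | G₁ ω ≤ x} = ENNReal.ofReal (exp (-exp (-(x - ν₁)))))
    (hcdf₂ : ∀ x, μ {ω | G₂ ω ≤ x} = ENNReal.ofReal (exp (-exp (-(x - ν₂)))))
    (hint : Integrable G₁ μ) :
    (∫ ω in {ω | G₂ ω ≤ G₁ ω}, G₁ ω ∂μ) / (μ {ω | G₂ ω ≤ G₁ ω}).toReal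
      = Real.eulerMascheroniConstant + ν₁ + log (1 + exp (-(ν₁ - ν₂))) := by
  have hm₁ : Measurable fun ω ↦ exp (-G₁ ω) := by fun_prop
  have hm₂ : Measurable fun ω ↦ exp (-G₂ ω) := by fun_prop
  have hlaw₁ := map_exp_neg_eq_expMeasure hmeas₁ hcdf₁
  have hlaw₂ := map_exp_neg_eq_expMeasure hmeas₂ hcdf₂
  have hprod : μ.map (fun ω ↦ (exp (-G₁ ω), exp (-G₂ ω))) =
      (expMeasure (exp ν₁)).prod (expMeasure (exp ν₂)) := by
    rw [← hlaw₁, ← hlaw₂]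
    refine (indepFun_iff_map_prod_eq_prod_map_map hm₁.aemeasurable hm₂.aemeasurable).1 ?_
    exact hindep.comp (φ := fun x ↦ exp (-x)) (ψ := fun x ↦ exp (-x)) (by fun_prop) (by fun_prop)
  have hset : {ω | G₂ ω ≤ G₁ ω} =
      (fun ω ↦ (exp (-G₁ ω), exp (-G₂ ω))) ⁻¹' {p : ℝ × ℝ | p.1 ≤ p.2} := by
    ext ω; simp
  have transfer {f : ℝ → ℝ} (hf : Measurable f) (hfi : Integrable (fun ω ↦ f (exp (-G₁ ω))) μ) :
      ∫ ω in {ω | G₂ ω ≤ G₁ ω}, f (exp (-G₁ ω)) ∂μ =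
        exp ν₁ * ∫ x in Set.Ioi 0, f x * exp (-((exp ν₁ + exp ν₂) * x)) := by
    rw [← setIntegral_prod_expMeasure_le (exp_pos _) (exp_pos _), ← hprod, hset,
      setIntegral_map (f := fun p : ℝ × ℝ ↦ f p.1) (measurableSet_le measurable_fst measurable_snd)
        (hf.comp measurable_fst).aestronglyMeasurable (hm₁.prodMk hm₂).aemeasurable]
    rw [← hlaw₁]
    exact (integrable_map_measure hf.aestronglyMeasurable hm₁.aemeasurable).2 hfi
  have hnum := transfer measurable_log (by simpa using hint.neg)
  have hden := transfer (f := fun _ ↦ 1) measurable_const (integrable_const _)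
  have hc : 0 < exp ν₁ + exp ν₂ := by positivity
  simp only [log_exp, integral_neg, integral_Ioi_log_mul_exp_neg_mul hc] at hnum
  simp only [one_mul, integral_Ioi_exp_neg_mul hc, integral_const, smul_eq_mul, mul_one,
    measureReal_def, Measure.restrict_apply_univ] at hden
  rw [hden, neg_eq_iff_eq_neg.1 hnum]
  have hlog : log (exp ν₁ + exp ν₂) = ν₁ + log (1 + exp (-(ν₁ - ν₂))) := by
    rw [show exp ν₁ + exp ν₂ = exp ν₁ * (1 + exp (-(ν₁ - ν₂))) by
      rw [mul_add, ← exp_add]; ring_nf, log_mul (exp_pos _).ne' (by positivity), log_exp]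
  rw [add_assoc, ← hlog]
  field_simp
  ring
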